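/- Let T be a tree on vertices 1,…,n and let A be an n×n real T-TP matrix such that det A > 0 and, for every pendant vertex q of T, the principal submatrix of A obtained by deleting row q and column q is a P-matrix. Let σ : {1,…,n} → {+1,−1} be a sign function with σ_u = −σ_v for every edge {u,v} of T, normalized so that the diagonal entries of the adjugate ã of A are positive. Suppose i and k are two non-pendant vertices of T for which there exists NO pendant vertex p of T with both i ≤ p and k ≤ p, nor one with both p ≤ i and p ≤ k (as labels). Then sign(ã_{k,i}) = σ_k · σ_i. -/

import Mathlib

open Matrix

/-- Every minor (rows and columns taken in increasing order) is positive. -/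
def IsTotallyPositive {m : ℕ} (M : Matrix (Fin m) (Fin m) ℝ) : Prop :=
  ∀ (k : ℕ) (f g : Fin k → Fin m), StrictMono f → StrictMono g →
    0 < (M.submatrix f g).det

/-- `A` is T-TP: for every (induced) path of `T`, the submatrix of `A` whose rows and
columns are indexed by the vertices of the path, in path order, is totally positive. -/
def IsTTP {n : ℕ} (T : SimpleGraph (Fin n)) (A : Matrix (Fin n) (Fin n) ℝ) : Prop :=
  ∀ (u v : Fin n) (w : T.Walk u v), w.IsPath →
    IsTotallyPositive (Matrix.of fun s t : Fin w.support.length =>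
      A (w.support.get s) (w.support.get t))

/-- All principal minors are positive. -/
def IsPMatrix {m : Type*} [Fintype m] [DecidableEq m] (M : Matrix m m ℝ) : Prop :=
  ∀ s : Finset m, 0 < (M.submatrix (fun i : s => (i : m)) (fun i : s => (i : m))).det

/-- A pendant vertex: a vertex of degree one. -/
def Pendant {n : ℕ} (T : SimpleGraph (Fin n)) (p : Fin n) : Prop :=
  ∃! u : Fin n, T.Adj p u

/-- The principal submatrix obtained by deleting row `p` and column `p`. -/
def deleteVertex {n : ℕ} (A : Matrix (Fin n) (Fin n) ℝ) (p : Fin n) :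
    Matrix {i : Fin n // i ≠ p} {i : Fin n // i ≠ p} ℝ :=
  A.submatrix (fun i => (i : Fin n)) (fun i => (i : Fin n))

/-- `σ` is a ±1 sign function alternating along the edges of `T`. -/
def IsSigning {n : ℕ} (T : SimpleGraph (Fin n)) (σ : Fin n → ℝ) : Prop :=
  (∀ i, σ i = 1 ∨ σ i = -1) ∧ ∀ u v : Fin n, T.Adj u v → σ u = -σ v

section Minors

variable {V : Type*} [Fintype V] [DecidableEq V]

theorem IsPMatrix.submatrix {m m' : Type*} [Fintype m] [DecidableEq m] [Fintype m']
    [DecidableEq m'] {M : Matrix m m ℝ} (hM : IsPMatrix M) (e : m' ↪ m) :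
    IsPMatrix (M.submatrix e e) := by
  intro s
  have h := hM (s.map e)
  rwa [← Matrix.det_submatrix_equiv_self (s.equivMap e)] at h

theorem IsPMatrix.det_pos {m : Type*} [Fintype m] [DecidableEq m] {M : Matrix m m ℝ}
    (hM : IsPMatrix M) : 0 < M.det := by
  rw [← Matrix.det_submatrix_equiv_self (Equiv.subtypeUnivEquiv Finset.mem_univ) M]
  exact hM Finset.univ

/-- The principal submatrix obtained by deleting the row and the column of one index. -/
def Matrix.eraseIndex (A : Matrix V V ℝ) (q : V) : Matrix {i // i ≠ q} {i // i ≠ q} ℝ :=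
  A.submatrix Subtype.val Subtype.val

theorem Matrix.adjugate_apply_self_eq_det_eraseIndex (A : Matrix V V ℝ) (q : V) :
    A.adjugate q q = (A.eraseIndex q).det := by
  rw [adjugate_apply, twoBlockTriangular_det _ (fun i => i ≠ q)]
  · have h : (toSquareBlockProp (A.updateRow q (Pi.single q 1)) fun i => ¬ i ≠ q) = 1 := by
      ext ⟨i, hi⟩ ⟨j, hj⟩
      obtain rfl := not_not.1 hi
      obtain rfl := not_not.1 hj
      simp [toSquareBlockProp]
    rw [h, det_one, mul_one]
    congr 1
    ext ⟨i, hi⟩ ⟨j, hj⟩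
    simp [toSquareBlockProp, eraseIndex, updateRow_ne hi]
  · intro i hi j hj
    obtain rfl := not_not.1 hi
    simp [hj]

/-- The Desnanot–Jacobi identity for the minors of the adjugate. -/
theorem Matrix.adjugate_mul_sub_mul_eq_det_mul_adjugate_eraseIndex (A : Matrix V V ℝ) (q : V)
    (hq : (A.eraseIndex q).det ≠ 0) (i j : {i // i ≠ q}) :
    A.adjugate i j * A.adjugate q q - A.adjugate i q * A.adjugate q j =
      A.det * (A.eraseIndex q).adjugate i j := by
  set M : Matrix {i // i ≠ q} {i // i ≠ q} ℝ := .of fun i j =>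
    A.adjugate i j * A.adjugate q q - A.adjugate i q * A.adjugate q j with hMdef
  have hAM : A.eraseIndex q * M = (A.det * A.adjugate q q) • 1 := by
    ext l j
    have hsum (j : V) : ∑ m, A l m * A.adjugate m j = A.det * (1 : Matrix V V ℝ) l j := by
      simpa [mul_apply] using congrFun (congrFun A.mul_adjugate l) j
    have hext : ∑ m : {i // i ≠ q}, A l m *
          (A.adjugate m j * A.adjugate q q - A.adjugate m q * A.adjugate q j) =
        ∑ m, A l m * (A.adjugate m j * A.adjugate q q - A.adjugate m q * A.adjugate q j) := by
      rw [← Finset.sum_erase (a := q) Finset.univ (by ring)]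
      exact (Finset.sum_subtype _ (by simp) fun m => A l m *
        (A.adjugate m j * A.adjugate q q - A.adjugate m q * A.adjugate q j)).symm
    calc (A.eraseIndex q * M) l j
        = ∑ m, A l m * (A.adjugate m j * A.adjugate q q - A.adjugate m q * A.adjugate q j) := by
          simpa [mul_apply, eraseIndex, hMdef] using hext
      _ = (∑ m, A l m * A.adjugate m j) * A.adjugate q q -
            (∑ m, A l m * A.adjugate m q) * A.adjugate q j := by
          rw [Finset.sum_mul, Finset.sum_mul, ← Finset.sum_sub_distrib]
          exact Finset.sum_congr rfl fun _ _ => by ring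
      _ = ((A.det * A.adjugate q q) • (1 : Matrix {i // i ≠ q} {i // i ≠ q} ℝ)) l j := by
          rw [hsum, hsum, one_apply_ne l.2]
          simp [one_apply, Subtype.ext_iff]
  have key := congrArg ((A.eraseIndex q).adjugate * ·) hAM
  simp only [← Matrix.mul_assoc, adjugate_mul, Matrix.mul_smul, Matrix.mul_one, Matrix.smul_mul,
    Matrix.one_mul] at key
  have := congrFun (congrFun key i) j
  simp only [smul_apply, smul_eq_mul, A.adjugate_apply_self_eq_det_eraseIndex q] at this
  have hM : M i j = A.det * (A.eraseIndex q).adjugate i j :=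
    mul_left_cancel₀ hq (by linarith)
  exact hM

end Minors

section Domination

variable {V : Type*} {D : V → V → ℝ} {L : V → Prop}

theorem pos_of_mul_lt_mul_of_mem
    (hdom : ∀ q, L q → ∀ i j, i ≠ q → j ≠ q → D i q * D q j < D i j * D q q)
    (hdiag : ∀ q, L q → 0 < D q q) {p q r : V} (hp : L p) (hq : L q) (hr : L r)
    (hpq : p ≠ q) (hrp : r ≠ p) (hrq : r ≠ q) : 0 < D p q := by
  by_contra! hneg
  have hP := hdiag p hp
  have hQ := hdiag q hq
  have hR := hdiag r hr
  have h1 := hdom r hr p q hrp.symm hrq.symm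
  have h2 : D p r * D r q < 0 := h1.trans_le (mul_nonpos_of_nonpos_of_nonneg hneg hR.le)
  rcases mul_neg_iff.1 h2 with ⟨ha, hb⟩ | ⟨ha, hb⟩
  · have h3 := hdom p hp r q hrp hpq.symm
    have h4 : 0 < D r p := by
      by_contra! h
      nlinarith [mul_nonneg_of_nonpos_of_nonpos h hneg, mul_neg_of_neg_of_pos hb hP]
    have h5 := hdom r hr p p hrp.symm hrp.symm
    nlinarith [mul_lt_mul_of_pos_right h1 h4, mul_lt_mul_of_pos_right h3 hR,
      mul_lt_mul_of_neg_left h5 hb]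
  · have h3 := hdom q hq p r hpq hrq
    have h4 : 0 < D q r := by
      by_contra! h
      nlinarith [mul_nonneg_of_nonpos_of_nonpos h hneg, mul_neg_of_neg_of_pos ha hQ]
    have h5 := hdom r hr q q hrq.symm hrq.symm
    nlinarith [mul_lt_mul_of_pos_right h1 h4, mul_lt_mul_of_pos_right h3 hR,
      mul_lt_mul_of_neg_left h5 ha]

theorem pos_of_mul_lt_mul_of_mem_right
    (hdom : ∀ q, L q → ∀ i j, i ≠ q → j ≠ q → D i q * D q j < D i j * D q q)
    (hdiag : ∀ q, L q → 0 < D q q) (hL : ∀ i j, ∃ q, L q ∧ q ≠ i ∧ q ≠ j)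
    (i : V) {p : V} (hp : L p) : 0 < D i p := by
  obtain rfl | hip := eq_or_ne i p
  · exact hdiag i hp
  obtain ⟨q, hq, hqi, hqp⟩ := hL i p
  obtain ⟨r, hr, hrp, hrq⟩ := hL p q
  have hpq := pos_of_mul_lt_mul_of_mem hdom hdiag hp hq hr hqp.symm hrp hrq
  have hqp' := pos_of_mul_lt_mul_of_mem hdom hdiag hq hp hr hqp hrq hrp
  have h1 := hdom q hq i p hqi.symm hqp.symm
  have h2 := hdom p hp i q hip hqp
  have h3 := hdom q hq p p hqp.symm hqp.symm
  have hP := hdiag p hp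
  have hQ := hdiag q hq
  by_contra! hneg
  have h4 : D i q < 0 := by
    by_contra! h
    nlinarith [mul_nonneg h hqp'.le, mul_nonpos_of_nonpos_of_nonneg hneg hQ.le]
  nlinarith [mul_lt_mul_of_pos_right h1 hpq, mul_lt_mul_of_pos_right h2 hQ,
    mul_lt_mul_of_neg_left h3 h4]

/-- If the entries of `D` dominate the rank-one corrections at the pivots in `L`, and `L` has at
least three elements, then `D` is entrywise positive. -/
theorem pos_of_mul_lt_mul
    (hdom : ∀ q, L q → ∀ i j, i ≠ q → j ≠ q → D i q * D q j < D i j * D q q)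
    (hdiag : ∀ q, L q → 0 < D q q) (hL : ∀ i j, ∃ q, L q ∧ q ≠ i ∧ q ≠ j)
    (i j : V) : 0 < D i j := by
  obtain ⟨q, hq, hqi, hqj⟩ := hL i j
  have h1 := pos_of_mul_lt_mul_of_mem_right hdom hdiag hL i hq
  have h2 := pos_of_mul_lt_mul_of_mem_right (D := fun i j => D j i)
    (fun q hq i j hi hj => by simpa [mul_comm] using hdom q hq j i hj hi) hdiag hL j hq
  exact pos_of_mul_pos_left ((mul_pos h1 h2).trans (hdom q hq i j hqi.symm hqj.symm))
    (hdiag q hq).le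

end Domination

section Trees

variable {V : Type*} {T : SimpleGraph V}

/-- A tree that is not covered by the path between two of its leaves has a third leaf. -/
theorem SimpleGraph.IsTree.exists_leaf_ne_ne [Finite V] (hT : T.IsTree) {p q x : V}
    (w : T.Walk p q) (hw : w.IsPath) (hx : x ∉ w.support) :
    ∃ r, (∃! u, T.Adj r u) ∧ r ≠ p ∧ r ≠ q := by
  classical
  choose π hπ hπ' using hT.existsUnique_path p
  have : Nonempty {x // x ∉ w.support} := ⟨⟨x, hx⟩⟩
  obtain ⟨⟨r, hr⟩, hmax⟩ := Finite.exists_max fun x : {x // x ∉ w.support} => (π x).length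
  have hrp : r ≠ p := fun h => hr (h ▸ w.start_mem_support)
  have hrq : r ≠ q := fun h => hr (h ▸ w.end_mem_support)
  have hnil : ¬ (π r).Nil := fun h => hrp h.eq.symm
  refine ⟨r, ⟨(π r).penultimate, ((π r).adj_penultimate hnil).symm, fun y hy => ?_⟩, hrp, hrq⟩
  by_contra hne
  have hy' : y ∉ (π r).support := fun h =>
    hne (hT.isAcyclic.eq_penultimate_of_adj_end (hπ r) hy h)
  have hcat := hπ' y _ ((hπ r).concat hy' hy)
  have hyw : y ∉ w.support := by
    intro h
    have htake := hπ' y _ (hw.takeUntil h)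
    apply hr
    apply w.support_takeUntil_subset_support h
    rw [htake, ← hcat]
    exact SimpleGraph.Walk.support_subset_support_concat _ _ (SimpleGraph.Walk.end_mem_support _)
  have := hmax ⟨y, hyw⟩
  simp [← hcat] at this

/-- Removing a leaf from a tree leaves a tree. -/
theorem SimpleGraph.IsTree.comap_val_ne [Finite V] (hT : T.IsTree) {q : V} (hq : ∃! u, T.Adj q u) :
    (T.comap (Subtype.val : {i // i ≠ q} → V)).IsTree := by
  classical
  refine ⟨?_, hT.isAcyclic.of_comap (Function.Embedding.subtype _)⟩
  have : Fintype (T.neighborSet q) := Fintype.ofFinite _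
  exact hT.connected.induce_compl_singleton_of_degree_eq_one
    (T.degree_eq_one_iff_existsUnique_adj.2 hq)

theorem sign_getVert {σ : V → ℝ} (hσ : ∀ u v, T.Adj u v → σ u = -σ v) {p q : V}
    (w : T.Walk p q) {m : ℕ} (hm : m ≤ w.length) : σ (w.getVert m) = (-1) ^ m * σ p := by
  induction m with
  | zero => simp
  | succ m ih =>
    have := hσ _ _ (w.adj_getVert_succ (i := m) (by omega))
    rw [ih (by omega)] at this
    rw [pow_succ]
    linarith

end Trees

section Signing

theorem IsTotallyPositive.adjugate_pos {m : ℕ} {M : Matrix (Fin m) (Fin m) ℝ}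
    (hM : IsTotallyPositive M) (i j : Fin m) :
    0 < (-1) ^ (i + j : ℕ) * M.adjugate i j := by
  cases m with
  | zero => exact i.elim0
  | succ m =>
    rw [Matrix.adjugate_fin_succ_eq_det_submatrix, add_comm (j : ℕ), ← mul_assoc, ← mul_pow]
    simpa using hM m _ _ (Fin.strictMono_succAbove j) (Fin.strictMono_succAbove i)

variable {V : Type*}

/-- The submatrices of `A` along all paths of `T` are totally positive. -/
def TotallyPositiveOnPaths (T : SimpleGraph V) (A : Matrix V V ℝ) : Prop :=
  ∀ (u v : V) (w : T.Walk u v), w.IsPath →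
    IsTotallyPositive (A.submatrix w.support.get w.support.get)

theorem TotallyPositiveOnPaths.comap {W : Type*} {T : SimpleGraph V} {A : Matrix V V ℝ}
    (h : TotallyPositiveOnPaths T A) (e : W ↪ V) :
    TotallyPositiveOnPaths (T.comap e) (A.submatrix e e) := by
  intro u v w hw
  have h' := h _ _ (w.map (SimpleGraph.Embedding.comap e T).toHom)
    (hw.map e.injective)
  rw [SimpleGraph.Walk.support_map] at h'
  intro k f g hf hg
  have := h' k (Fin.cast (by simp) ∘ f) (Fin.cast (by simp) ∘ g) (fun a b hab => hf hab)
    (fun a b hab => hg hab)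
  convert this using 2
  ext a b
  simp

/-- A path-wise totally positive matrix whose graph is covered by one path has signed adjugate. -/
theorem TotallyPositiveOnPaths.adjugate_pos_of_forall_mem_support [Fintype V] [DecidableEq V]
    {T : SimpleGraph V} {A : Matrix V V ℝ} (h : TotallyPositiveOnPaths T A) {σ : V → ℝ}
    (hσ1 : ∀ i, σ i = 1 ∨ σ i = -1) (hσ : ∀ u v, T.Adj u v → σ u = -σ v) {p q : V}
    (w : T.Walk p q) (hw : w.IsPath) (hmem : ∀ x, x ∈ w.support) (k i : V) :
    0 < σ k * σ i * A.adjugate k i := by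
  let e := hw.support_nodup.getEquivOfForallMemList _ hmem
  have hsign (a : Fin w.support.length) : σ (e a) = (-1) ^ (a : ℕ) * σ p := by
    rw [← sign_getVert hσ w (by have := a.2; simp at this; omega)]
    simp [e, SimpleGraph.Walk.support_getElem_eq_getVert]
  obtain ⟨a, rfl⟩ := e.surjective k
  obtain ⟨b, rfl⟩ := e.surjective i
  have hpos := (h p q w hw).adjugate_pos a b
  have hadj : (A.submatrix w.support.get w.support.get).adjugate a b = A.adjugate (e a) (e b) :=
    congrFun (congrFun (Matrix.adjugate_submatrix_equiv_self e A) a) b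
  rw [hadj, pow_add] at hpos
  rw [hsign, hsign]
  have hsq : σ p * σ p = 1 := by rcases hσ1 p with h | h <;> simp [h]
  calc _ < _ := hpos
    _ = (-1) ^ (a : ℕ) * (-1) ^ (b : ℕ) * A.adjugate (e a) (e b) * (σ p * σ p) := by
      rw [hsq, mul_one]
    _ = _ := by ring

/-- The adjugate of a path-wise totally positive matrix on a tree, with positive determinant and
with P-matrices after deletion of any leaf, is signed according to the tree. -/
theorem TotallyPositiveOnPaths.adjugate_pos (N : ℕ) : ∀ {V : Type} [Fintype V] [DecidableEq V]
    {T : SimpleGraph V}, Fintype.card V = N → T.IsTree → ∀ {A : Matrix V V ℝ},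
    TotallyPositiveOnPaths T A → 0 < A.det →
    (∀ q, (∃! u, T.Adj q u) → IsPMatrix (A.eraseIndex q)) →
    ∀ {σ : V → ℝ}, (∀ i, σ i = 1 ∨ σ i = -1) → (∀ u v, T.Adj u v → σ u = -σ v) →
    ∀ k i, 0 < σ k * σ i * A.adjugate k i := by
  induction N with
  | zero =>
    intro V _ _ T hcard hT A hA hdet hP σ hσ1 hσ k i
    exact ((Fintype.card_eq_zero_iff.1 hcard).false k).elim
  | succ N ih =>
    intro V _ _ T hcard hT A hA hdet hP σ hσ1 hσ
    have hsq (v : V) : σ v * σ v = 1 := by rcases hσ1 v with h | h <;> simp [h]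
    classical
    cases subsingleton_or_nontrivial V with
    | inl hV =>
      intro k i
      obtain rfl := Subsingleton.elim k i
      simp [Matrix.adjugate_subsingleton, hsq]
    | inr hV =>
      obtain ⟨p, q, hpq, hp, hq⟩ := hT.exists_ne_and_degree_eq_one
      rw [SimpleGraph.degree_eq_one_iff_existsUnique_adj] at hp hq
      obtain ⟨w, hw, -⟩ := hT.existsUnique_path p q
      by_cases hmem : ∀ x, x ∈ w.support
      · exact hA.adjugate_pos_of_forall_mem_support hσ1 hσ w hw hmem
      push Not at hmem
      obtain ⟨x, hx⟩ := hmem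
      obtain ⟨r, hr, hrp, hrq⟩ := hT.exists_leaf_ne_ne w hw hx
      refine pos_of_mul_lt_mul (D := fun i j => σ i * σ j * A.adjugate i j)
        (L := fun q => ∃! u, T.Adj q u) ?_ ?_ ?_
      · intro q hq i j hi hj
        have hsub := ih (V := {i // i ≠ q}) (by simp [Fintype.card_subtype_compl, hcard])
          (hT.comap_val_ne hq) (A := A.eraseIndex q) (hA.comap (Function.Embedding.subtype _))
          (hP q hq).det_pos
          (fun q' _ => (hP q hq).submatrix (Function.Embedding.subtype _))
          (σ := fun v => σ v) (fun v => hσ1 v) (fun u v huv => hσ u v huv) ⟨i, hi⟩ ⟨j, hj⟩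
        have hid := A.adjugate_mul_sub_mul_eq_det_mul_adjugate_eraseIndex q
          (hP q hq).det_pos.ne' ⟨i, hi⟩ ⟨j, hj⟩
        dsimp only at hsub hid
        have hpos := mul_pos hdet hsub
        rw [← sub_pos]
        have hexp : σ i * σ j * A.adjugate i j * (σ q * σ q * A.adjugate q q) -
            σ i * σ q * A.adjugate i q * (σ q * σ j * A.adjugate q j) =
            σ i * σ j * (σ q * σ q) * (A.adjugate i j * A.adjugate q q -
              A.adjugate i q * A.adjugate q j) := by ring
        rw [hexp, hid, hsq]
        linarith
      · intro q hq
        simpa [hsq, A.adjugate_apply_self_eq_det_eraseIndex] using (hP q hq).det_pos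
      · intro i j
        by_cases hpi : p ≠ i ∧ p ≠ j
        · exact ⟨p, hp, hpi⟩
        by_cases hqi : q ≠ i ∧ q ≠ j
        · exact ⟨q, hq, hqi⟩
        exact ⟨r, hr, by grind⟩

end Signing

/-- Lemma 2.6: if `i` and `k` are non-pendant vertices such that no pendant vertex `p`
satisfies `i ≤ p` and `k ≤ p`, nor `p ≤ i` and `p ≤ k`, then
`sign(ã_{k,i}) = σ_k σ_i`. -/
theorem ttp_adjugate_sign_nonpendant_otherside {n : ℕ} (T : SimpleGraph (Fin n))
    (hT : T.IsTree)
    (A : Matrix (Fin n) (Fin n) ℝ) (hTTP : IsTTP T A) (hdet : 0 < A.det)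
    (hP : ∀ q : Fin n, Pendant T q → IsPMatrix (deleteVertex A q))
    (σ : Fin n → ℝ) (hσ : IsSigning T σ)
    (i k : Fin n) (hi : ¬ Pendant T i) (hk : ¬ Pendant T k)
    (hp : ¬ ∃ p : Fin n, Pendant T p ∧ ((i ≤ p ∧ k ≤ p) ∨ (p ≤ i ∧ p ≤ k))) :
    0 < σ k * σ i * A.adjugate k i :=
  TotallyPositiveOnPaths.adjugate_pos n (Fintype.card_fin n) hT hTTP hdet hP hσ.1 hσ.2 k i
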